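/- Let K be an algebraically closed field of characteristic 0 and let E ⊆ ℙ²_K be a smooth Weierstrass cubic (an elliptic curve). Then E contains no rational curve; equivalently, every morphism ℙ¹_K → E is constant. Concretely: if F₀, F₁, F₂ ∈ K[s,t] are homogeneous of the same degree d ≥ 0 with no common zero in ℙ¹(K) and the Weierstrass equation of E vanishes identically when evaluated at (F₀, F₁, F₂), then the point (F₀(s,t) : F₁(s,t) : F₂(s,t)) ∈ ℙ²(K) is the same for all (s : t) ∈ ℙ¹(K). -/

import Mathlib

noncomputable section

open MvPolynomial
open MvPolynomial

def vecHeight {K : Type} [Field K] [NumberField K] {N : ℕ} (x : Fin N → K) : ℝ :=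
  (((FractionalIdeal.absNorm
        (∑ i, FractionalIdeal.spanSingleton
          (nonZeroDivisors (NumberField.RingOfIntegers K)) (x i)) : ℚ) : ℝ)⁻¹ *
      ∏ w : NumberField.InfinitePlace K, (⨆ i, w (x i)) ^ w.mult) ^
    ((Module.finrank ℚ K : ℝ)⁻¹)

def projHeight {K : Type} [Field K] [NumberField K] {n : ℕ}
    (x : Projectivization K (Fin (n + 1) → K)) : ℝ :=
  vecHeight x.rep

/-! ### Projective zero loci, counting, sparsity -/

/-- The set of `L`-rational points of the Zariski closed subset of `ℙⁿ` cut out by the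
set `S` of (homogeneous) polynomials with coefficients in `k`. -/
def projZeroLocus (k : Type) [CommRing k] {n : ℕ} (S : Set (MvPolynomial (Fin (n + 1)) k))
    (L : Type) [Field L] [Algebra k L] : Set (Projectivization L (Fin (n + 1) → L)) :=
  {x | ∀ f ∈ S, eval x.rep (map (algebraMap k L) f) = 0}

/-- A set `S` of points (of projective space over a number field, say) is *sparse* with
respect to a height function `H` if for every `ε > 0` the number of points of `S` of
height at most `T` is `O_ε(T ^ ε)`. -/
def IsSparseWrt {P : Type} (S : Set P) (H : P → ℝ) : Prop :=
  ∀ ε : ℝ, 0 < ε → ∃ C : ℝ, 0 < C ∧ ∀ T : ℝ, 1 ≤ T →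
    {x | x ∈ S ∧ H x ≤ T}.Finite ∧ ({x | x ∈ S ∧ H x ≤ T}.ncard : ℝ) ≤ C * T ^ ε

/-- Sparsity with respect to the standard projective Weil height. -/
def IsSparse {L : Type} [Field L] [NumberField L] {n : ℕ}
    (S : Set (Projectivization L (Fin (n + 1) → L))) : Prop :=
  IsSparseWrt S projHeight

/-- The closed subset of `ℙⁿ` over a number field `k` cut out by `S` is *xeric* if its set
of `L`-rational points is sparse for every finite extension `L/k`. -/
def IsXeric (k : Type) [Field k] [NumberField k] {n : ℕ}
    (S : Set (MvPolynomial (Fin (n + 1)) k)) : Prop :=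
  ∀ (L : Type) [Field L] [NumberField L] [Algebra k L] [FiniteDimensional k L],
    IsSparse (projZeroLocus k S L)

/-! ### Geometric irreducibility and smoothness, via equations -/

/-- The closed subvariety of `ℙⁿ` cut out by `S` is geometrically integral (a
"geometrically irreducible variety"), expressed over a given algebraically closed
extension `K` of the ground field: the radical of the homogeneous ideal generated by `S`
is prime, and the corresponding cone has a nonzero point. -/
def GeomIntegralOver (k K : Type) [Field k] [Field K] [Algebra k K] {n : ℕ}
    (S : Set (MvPolynomial (Fin (n + 1)) k)) : Prop :=
  (Ideal.span ((map (algebraMap k K)) '' S)).radical.IsPrime ∧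
    ∃ x : Fin (n + 1) → K, x ≠ 0 ∧ ∀ f ∈ S, eval x (map (algebraMap k K) f) = 0

/-- Smoothness (of pure dimension `d`) of the closed subvariety of `ℙⁿ` cut out by `S`,
via the Jacobian criterion: at every nonzero point `x` of the affine cone over an
algebraically closed extension `K`, the space spanned by the gradients of the elements of
the homogeneous ideal of `X` has rank `n - d`. -/
def SmoothOfDimOver (k K : Type) [Field k] [Field K] [Algebra k K] {n : ℕ}
    (S : Set (MvPolynomial (Fin (n + 1)) k)) (d : ℕ) : Prop :=
  ∀ x : Fin (n + 1) → K, x ≠ 0 →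
    (∀ f ∈ S, eval x (map (algebraMap k K) f) = 0) →
    Module.finrank K
      (Submodule.span K
        {g : Fin (n + 1) → K |
          ∃ f ∈ Ideal.span ((map (algebraMap k K)) '' S),
            g = fun j => eval x (pderiv j f)}) = n - d
open MvPolynomial

/-! ### Morphisms of projective varieties, given by finitely many polynomial charts -/

/-- Data describing a morphism from a closed subvariety of `ℙᵐ` to `ℙⁿ`: finitely many
"charts", each of which is an `(n+1)`-tuple of homogeneous polynomials of a common
degree in the `m+1` homogeneous coordinates. -/
structure ChartMap (k : Type) [CommRing k] (m n : ℕ) where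
  numCharts : ℕ
  F : Fin numCharts → Fin (n + 1) → MvPolynomial (Fin (m + 1)) k
  deg : Fin numCharts → ℕ
  homog : ∀ c i, (F c i).IsHomogeneous (deg c)

/-- Evaluation of the chart `c` of a `ChartMap` on a coordinate vector with entries in a
`k`-algebra `A`. -/
def ChartMap.evalVec {k : Type} [CommRing k] {m n : ℕ} (Φ : ChartMap k m n)
    {A : Type} [CommRing A] [Algebra k A] (c : Fin Φ.numCharts) (y : Fin (m + 1) → A) :
    Fin (n + 1) → A :=
  fun i => eval y (map (algebraMap k A) (Φ.F c i))

/-- Base change of the polynomial data of a chart map along `k → K`. -/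
def ChartMap.baseChange {k K : Type} [CommRing k] [CommRing K] [Algebra k K] {m n : ℕ}
    (Φ : ChartMap k m n) : ChartMap K m n where
  numCharts := Φ.numCharts
  F := fun c i => map (algebraMap k K) (Φ.F c i)
  deg := Φ.deg
  homog := fun c i => (Φ.homog c i).map _

/-- The `A`-points of the closed subscheme of `ℙⁿ` cut out by `S`, for a (local)
`k`-algebra `A`, described by coordinate vectors: vectors, one of whose coordinates is a
unit, on which all the equations vanish.  (Two such vectors describe the same `A`-point
iff they differ by a unit scalar, see `unitEquiv`.) -/
def ringPoints (k : Type) [CommRing k] {n : ℕ} (S : Set (MvPolynomial (Fin (n + 1)) k))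
    (A : Type) [CommRing A] [Algebra k A] : Set (Fin (n + 1) → A) :=
  {a | (∃ i, IsUnit (a i)) ∧ ∀ f ∈ S, eval a (map (algebraMap k A) f) = 0}

/-- Two coordinate vectors describe the same point iff they differ by a unit scalar. -/
def unitEquiv {A : Type} [CommRing A] {N : ℕ} (a b : Fin N → A) : Prop :=
  ∃ u : Aˣ, b = fun i => (u : A) * a i

/-- The property that the chart data `Φ` defines a morphism from the closed subvariety
`Y ⊆ ℙᵐ` cut out by `SY` to the closed subvariety `X ⊆ ℙⁿ` cut out by `SX`:  on the
points of `Y` with values in any local `k`-algebra `A`, some chart is defined (has a unit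
coordinate), any two defined charts agree up to a unit scalar, and the image satisfies
the equations of `X`.  (The functor of points on local rings determines a morphism of
  schemes, and every morphism of quasi-projective varieties arises this way.) -/
structure IsChartMorphism (k : Type) [Field k] {m n : ℕ} (Φ : ChartMap k m n)
    (SY : Set (MvPolynomial (Fin (m + 1)) k)) (SX : Set (MvPolynomial (Fin (n + 1)) k)) :
    Prop where
  total : ∀ (A : Type) [CommRing A] [IsLocalRing A] [Algebra k A],
    ∀ a ∈ ringPoints k SY A, ∃ c i, IsUnit (Φ.evalVec c a i)
  compat : ∀ (A : Type) [CommRing A] [IsLocalRing A] [Algebra k A],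
    ∀ a ∈ ringPoints k SY A, ∀ c c', (∃ i, IsUnit (Φ.evalVec c a i)) →
      (∃ i, IsUnit (Φ.evalVec c' a i)) → unitEquiv (Φ.evalVec c a) (Φ.evalVec c' a)
  mapsInto : ∀ (A : Type) [CommRing A] [IsLocalRing A] [Algebra k A],
    ∀ a ∈ ringPoints k SY A, ∀ c, (∃ i, IsUnit (Φ.evalVec c a i)) →
      Φ.evalVec c a ∈ ringPoints k SX A

/-- The graph of the map induced by the chart data `Φ` on projective points over a field
`L`: `z` is the image of `x` if some chart of `Φ` is nonzero at (a representative of) `x`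
and `z` is the corresponding projective point. -/
def chartImage {k L : Type} [Field k] [Field L] [Algebra k L] {m n : ℕ}
    (Φ : ChartMap k m n) (x : Projectivization L (Fin (m + 1) → L))
    (z : Projectivization L (Fin (n + 1) → L)) : Prop :=
  ∃ c, ∃ h : Φ.evalVec c x.rep ≠ 0, z = Projectivization.mk L (Φ.evalVec c x.rep) h

/-! ### Finite étale morphisms, concretely -/

/-- The set of coordinate vectors of `A`-points of `Y` lying (up to a unit scalar, as
they must) over the `A`-point of `X` with coordinate vector `b`, under the map given by
the chart data `Φ`. -/
def fiberOver (k : Type) [Field k] {m n : ℕ} (Φ : ChartMap k m n)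
    (SY : Set (MvPolynomial (Fin (m + 1)) k)) (A : Type) [CommRing A] [Algebra k A]
    (b : Fin (n + 1) → A) : Set (Fin (m + 1) → A) :=
  {a | a ∈ ringPoints k SY A ∧ ∃ c, (∃ i, IsUnit (Φ.evalVec c a i)) ∧
    unitEquiv (Φ.evalVec c a) b}

/-- A set of coordinate vectors contains exactly `d` points up to unit scaling. -/
def HasExactlyPoints {A : Type} [CommRing A] {N : ℕ} (s : Set (Fin N → A)) (d : ℕ) :
    Prop :=
  ∃ r : Fin d → (Fin N → A), (∀ j, r j ∈ s) ∧
    (∀ j j', unitEquiv (r j) (r j') → j = j') ∧ ∀ a ∈ s, ∃ j, unitEquiv a (r j)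

/-- The morphism `Y → X` given by the chart data `Φ` is finite étale of degree `d`:
over every point of `X` with values in a local Artinian `k`-algebra with algebraically
closed residue field, the fiber consists of exactly `d` points.  (For a morphism of
projective varieties over a field of characteristic `0` this characterizes finite étale
morphisms of degree `d`.) -/
def IsFiniteEtaleOfDegree (k : Type) [Field k] {m n : ℕ} (Φ : ChartMap k m n)
    (SY : Set (MvPolynomial (Fin (m + 1)) k)) (SX : Set (MvPolynomial (Fin (n + 1)) k))
    (d : ℕ) : Prop :=
  ∀ (A : Type) [CommRing A] [IsLocalRing A] [IsArtinianRing A] [Algebra k A],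
    IsAlgClosed (IsLocalRing.ResidueField A) →
    ∀ b ∈ ringPoints k SX A, HasExactlyPoints (fiberOver k Φ SY A b) d

/-- Finite étale (of some positive degree). -/
def IsFiniteEtaleMor (k : Type) [Field k] {m n : ℕ} (Φ : ChartMap k m n)
    (SY : Set (MvPolynomial (Fin (m + 1)) k)) (SX : Set (MvPolynomial (Fin (n + 1)) k)) :
    Prop :=
  ∃ d : ℕ, 0 < d ∧ IsFiniteEtaleOfDegree k Φ SY SX d

/-! ### Rational curves -/

/-- Data for a morphism `ℙ¹ → ℙⁿ`: an `(n+1)`-tuple of binary forms of a common degree. -/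
structure RatCurveData (K : Type) [CommRing K] (n : ℕ) where
  d : ℕ
  P : Fin (n + 1) → MvPolynomial (Fin 2) K
  homog : ∀ i, (P i).IsHomogeneous d

/-- Evaluation of the tuple of binary forms at `(s, t)`. -/
def RatCurveData.evalAt {K : Type} [CommRing K] {n : ℕ} (Γ : RatCurveData K n)
    (s t : K) : Fin (n + 1) → K :=
  fun i => eval ![s, t] (Γ.P i)

/-- A subset `C` of `ℙⁿ(K)`, `K` algebraically closed, is a (possibly singular) rational
curve if it is the image of a non-constant morphism `ℙ¹ → ℙⁿ` (such an image is
automatically an integral closed curve). -/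
def IsRationalCurve (K : Type) [Field K] {n : ℕ}
    (C : Set (Projectivization K (Fin (n + 1) → K))) : Prop :=
  ∃ Γ : RatCurveData K n,
    (∀ s t : K, ¬(s = 0 ∧ t = 0) → Γ.evalAt s t ≠ 0) ∧
    (∃ s t s' t' : K, ¬(s = 0 ∧ t = 0) ∧ ¬(s' = 0 ∧ t' = 0) ∧
      ∀ u : K, Γ.evalAt s' t' ≠ u • Γ.evalAt s t) ∧
    C = {z | ∃ s t : K, ∃ h : Γ.evalAt s t ≠ 0, z = Projectivization.mk K (Γ.evalAt s t) h}

/-- The homogeneous Weierstrass cubic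
`Y²Z + a₁XYZ + a₃YZ² − X³ − a₂X²Z − a₄XZ² − a₆Z³` in `ℙ²`, with variables
`X 0 = X`, `X 1 = Y`, `X 2 = Z`. -/
def weierstrassHomog {k : Type} [CommRing k] (W : WeierstrassCurve k) :
    MvPolynomial (Fin 3) k :=
  X 1 ^ 2 * X 2 + C W.a₁ * X 0 * X 1 * X 2 + C W.a₃ * X 1 * X 2 ^ 2
    - X 0 ^ 3 - C W.a₂ * X 0 ^ 2 * X 2 - C W.a₄ * X 0 * X 2 ^ 2 - C W.a₆ * X 2 ^ 3

namespace MvPolynomial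

variable {σ K : Type*} [Field K]

theorem IsHomogeneous.sum_support_eq {Q : MvPolynomial σ K} {n : ℕ} (hQ : Q.IsHomogeneous n)
    {m : σ →₀ ℕ} (hm : m ∈ Q.support) : ∑ i ∈ m.support, m i = n := by
  rw [← hQ (mem_support_iff.mp hm), Finsupp.weight_apply, Finsupp.sum]
  simp

theorem IsHomogeneous.eval_smul {Q : MvPolynomial σ K} {n : ℕ} (hQ : Q.IsHomogeneous n)
    (u : K) (x : σ → K) : eval (u • x) Q = u ^ n * eval x Q := by
  rw [eval_eq, eval_eq, Finset.mul_sum]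
  refine Finset.sum_congr rfl fun m hm => ?_
  have hdeg := hQ.sum_support_eq hm
  simp only [Pi.smul_apply, smul_eq_mul, mul_pow, Finset.prod_mul_distrib,
    Finset.prod_pow_eq_pow_sum, hdeg]
  ring

theorem coeff_aeval_of_isHomogeneous {Q : MvPolynomial σ K} {n : ℕ} (hQ : Q.IsHomogeneous n)
    {p : σ → Polynomial K} {D : ℕ} (hp : ∀ i, (p i).natDegree ≤ D) :
    (aeval p Q).coeff (n * D) = eval (fun i => (p i).coeff D) Q := by
  have hprod (m : σ →₀ ℕ) (s : Finset σ) :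
      (∏ i ∈ s, p i ^ m i).natDegree ≤ (∑ i ∈ s, m i) * D ∧
        (∏ i ∈ s, p i ^ m i).coeff ((∑ i ∈ s, m i) * D) = ∏ i ∈ s, (p i).coeff D ^ m i := by
    classical
    induction s using Finset.induction_on with
    | empty => simp
    | insert i s hi ih =>
      have hpow := Polynomial.natDegree_pow_le_of_le (m i) (hp i)
      rw [Finset.prod_insert hi, Finset.prod_insert hi, Finset.sum_insert hi, add_mul]
      exact ⟨Polynomial.natDegree_mul_le_of_le hpow ih.1, by
        rw [Polynomial.coeff_mul_add_eq_of_natDegree_le hpow ih.1, ih.2,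
          Polynomial.coeff_pow_of_natDegree_le (hp i)]⟩
  rw [aeval_def, eval₂_eq, Polynomial.finsetSum_coeff, eval_eq]
  refine Finset.sum_congr rfl fun m hm => ?_
  have hdeg := hQ.sum_support_eq hm
  rw [Polynomial.algebraMap_eq, Polynomial.coeff_C_mul, ← hdeg, (hprod m _).2]

theorem derivative_aeval [Fintype σ] (p : σ → Polynomial K) (Q : MvPolynomial σ K) :
    Polynomial.derivative (aeval p Q) =
      ∑ i, Polynomial.derivative (p i) * aeval p (pderiv i Q) := by
  classical
  induction Q using MvPolynomial.induction_on with
  | C a => simp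
  | add f g hf hg => simp [hf, hg, mul_add, Finset.sum_add_distrib]
  | mul_X f i hf =>
    simp only [map_mul, aeval_X, Polynomial.derivative_mul, hf, Derivation.leibniz, smul_eq_mul,
      map_add, mul_add, Finset.sum_add_distrib, pderiv_X]
    rw [add_comm]
    congr 1
    · rw [Finset.sum_eq_single i] <;> simp +contextual [mul_comm]
    · rw [Finset.sum_mul]
      exact Finset.sum_congr rfl fun j _ => by ring

end MvPolynomial

theorem Polynomial.exists_sum_mul_eq_one {ι K : Type*} [Fintype ι] [Field K] [IsAlgClosed K]
    {q : ι → Polynomial K} (hq : ∀ x, ∃ i, (q i).eval x ≠ 0) :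
    ∃ c : ι → Polynomial K, ∑ i, c i * q i = 1 := by
  suffices h : (1 : Polynomial K) ∈ Submodule.span (Polynomial K) (Set.range q) by
    simpa using (Submodule.mem_span_range_iff_exists_fun _).mp h
  by_contra h
  obtain ⟨f, hf⟩ := IsPrincipalIdealRing.principal (Submodule.span (Polynomial K) (Set.range q))
  have hdvd (i : ι) : f ∣ q i := by
    have hi : q i ∈ Submodule.span (Polynomial K) (Set.range q) :=
      Submodule.subset_span ⟨i, rfl⟩
    rw [hf] at hi
    exact Ideal.mem_span_singleton.mp hi
  have hroot : ∃ x, f.eval x = 0 := by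
    by_cases hf0 : f = 0
    · exact ⟨0, by simp [hf0]⟩
    refine IsAlgClosed.exists_root f fun hdeg => h ?_
    rw [hf]
    exact Ideal.mem_span_singleton.mpr (Polynomial.isUnit_iff_degree_eq_zero.mpr hdeg).dvd
  obtain ⟨x, hx⟩ := hroot
  obtain ⟨i, hi⟩ := hq x
  exact hi (Polynomial.eval_eq_zero_of_dvd_of_eval_eq_zero (hdvd i) hx)

/-- A polynomial parametrization of a smooth plane curve of degree at least `3` is constant:
the cross product of the parametrization with its derivative is a multiple of the gradient of
the equation, whose degree is too large unless that multiple is zero. -/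
theorem natDegree_eq_zero_of_aeval_eq_zero {K : Type*} [Field K] [IsAlgClosed K] [CharZero K]
    {n : ℕ} (hn : 3 ≤ n) {Q : MvPolynomial (Fin 3) K} (hQ : Q.IsHomogeneous n)
    (hsmooth : ∀ x : Fin 3 → K, x ≠ 0 → eval x Q = 0 → ∃ i, eval x (pderiv i Q) ≠ 0)
    {p : Fin 3 → Polynomial K} (hp : ∀ x, ∃ i, (p i).eval x ≠ 0) (hpQ : aeval p Q = 0)
    (i : Fin 3) : (p i).natDegree = 0 := by
  obtain ⟨j, -, hj⟩ := Finset.exists_max_image Finset.univ (fun i => (p i).natDegree) ⟨i, by simp⟩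
  replace hj (i : Fin 3) : (p i).natDegree ≤ (p j).natDegree := hj i (Finset.mem_univ i)
  by_contra hi
  set D := (p j).natDegree with hD
  have hD0 : 0 < D := (Nat.pos_of_ne_zero hi).trans_le (hj i)
  set g : Fin 3 → Polynomial K := fun i => aeval p (pderiv i Q) with hg
  have horth : ∑ i, p i * g i = 0 := by
    have h := congrArg (aeval p) hQ.sum_X_mul_pderiv
    simpa [hpQ, map_sum] using h
  have horth' : ∑ i, Polynomial.derivative (p i) * g i = 0 := by
    rw [← derivative_aeval, hpQ, Polynomial.derivative_zero]
  have hgroot (x : K) : ∃ i, (g i).eval x ≠ 0 := by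
    have heval (R : MvPolynomial (Fin 3) K) :
        (aeval p R).eval x = eval (fun i => (p i).eval x) R := by
      rw [← Polynomial.coe_evalRingHom, aeval_def, hom_eval₂, Polynomial.algebraMap_eq,
        show (Polynomial.evalRingHom x).comp Polynomial.C = RingHom.id K by ext; simp]
      rfl
    obtain ⟨i, hi⟩ := hp x
    obtain ⟨k, hk⟩ := hsmooth (fun i => (p i).eval x) (fun h => hi (congrFun h i))
      (by rw [← heval, hpQ, Polynomial.eval_zero])
    exact ⟨k, by rwa [hg, heval]⟩
  obtain ⟨k, hk⟩ : ∃ k, (g k).coeff ((n - 1) * D) ≠ 0 := by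
    obtain ⟨k, hk⟩ := hsmooth (fun i => (p i).coeff D)
      (fun h => by
        have hlead : (p j).leadingCoeff = 0 := congrFun h j
        rw [Polynomial.leadingCoeff_eq_zero] at hlead
        simp [hD, hlead] at hD0)
      (by rw [← coeff_aeval_of_isHomogeneous hQ hj, hpQ, Polynomial.coeff_zero])
    exact ⟨k, by rwa [hg, coeff_aeval_of_isHomogeneous hQ.pderiv hj]⟩
  have hkdeg : 2 * D ≤ (g k).natDegree :=
    (Nat.mul_le_mul_right D (by omega)).trans (Polynomial.le_natDegree_of_ne_zero hk)
  set w : Fin 3 → Fin 3 → Polynomial K :=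
    fun i j => p i * Polynomial.derivative (p j) - p j * Polynomial.derivative (p i) with hw
  have hwdeg (i j : Fin 3) : (w i j).natDegree < 2 * D := by
    have h (i j : Fin 3) : (p i * Polynomial.derivative (p j)).natDegree ≤ D + (D - 1) :=
      Polynomial.natDegree_mul_le_of_le (hj i)
        ((Polynomial.natDegree_derivative_le _).trans (Nat.sub_le_sub_right (hj j) 1))
    exact (Polynomial.natDegree_sub_le_of_le (h i j) (h j i)).trans_lt (by omega)
  set a : Fin 3 → Polynomial K := ![w 1 2, w 2 0, w 0 1] with ha
  have hadeg (i : Fin 3) : (a i).natDegree < 2 * D := by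
    fin_cases i <;> exact hwdeg _ _
  have hag (i j : Fin 3) : a i * g j = a j * g i := by
    simp only [Fin.sum_univ_three] at horth horth'
    fin_cases i <;> fin_cases j <;> simp [ha, hw]
    · linear_combination Polynomial.derivative (p 2) * horth - p 2 * horth'
    · linear_combination -Polynomial.derivative (p 1) * horth + p 1 * horth'
    · linear_combination -Polynomial.derivative (p 2) * horth + p 2 * horth'
    · linear_combination Polynomial.derivative (p 0) * horth - p 0 * horth'
    · linear_combination Polynomial.derivative (p 1) * horth - p 1 * horth'
    · linear_combination -Polynomial.derivative (p 0) * horth + p 0 * horth'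
  obtain ⟨c, hc⟩ := Polynomial.exists_sum_mul_eq_one hgroot
  have hfactor (i : Fin 3) : a i = (∑ j, c j * a j) * g i := by
    calc a i = (∑ j, c j * g j) * a i := by rw [hc, one_mul]
      _ = (∑ j, c j * a j) * g i := by
        simp only [Finset.sum_mul, mul_assoc]
        exact Finset.sum_congr rfl fun j _ => by rw [mul_comm (g j), hag]
  have hzero : ∑ j, c j * a j = 0 := by
    by_contra h
    have hgk : g k ≠ 0 := fun h => hk (by simp [h])
    have := hadeg k
    rw [hfactor k, Polynomial.natDegree_mul h hgk] at this
    omega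
  have ha0 (i : Fin 3) : a i = 0 := by rw [hfactor i, hzero, zero_mul]
  have hw0 (i j : Fin 3) :
      p i * Polynomial.derivative (p j) = p j * Polynomial.derivative (p i) := by
    have h0 := ha0 0
    have h1 := ha0 1
    have h2 := ha0 2
    simp only [ha, hw, Matrix.cons_val] at h0 h1 h2
    fin_cases i <;> fin_cases j <;> simp <;> grind
  obtain ⟨b, hb⟩ := Polynomial.exists_sum_mul_eq_one hp
  have hdvd : p j ∣ Polynomial.derivative (p j) := by
    refine ⟨∑ i, b i * Polynomial.derivative (p i), ?_⟩
    calc Polynomial.derivative (p j) = (∑ i, b i * p i) * Polynomial.derivative (p j) := by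
          rw [hb, one_mul]
      _ = p j * ∑ i, b i * Polynomial.derivative (p i) := by
        rw [Finset.sum_mul, Finset.mul_sum]
        exact Finset.sum_congr rfl fun i _ => by rw [mul_assoc, hw0]; ring
  have hder : Polynomial.derivative (p j) = 0 :=
    Polynomial.eq_zero_of_dvd_of_natDegree_lt hdvd (Polynomial.natDegree_derivative_lt hD0.ne')
  exact hD0.ne' (Polynomial.derivative_eq_zero.mp hder)

section Weierstrass

theorem isHomogeneous_weierstrassHomog {k : Type} [CommRing k] (W : WeierstrassCurve k) :
    (weierstrassHomog W).IsHomogeneous 3 := by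
  have hX (i : Fin 3) : (X i : MvPolynomial (Fin 3) k).IsHomogeneous 1 := isHomogeneous_X k i
  have hC (a : k) : (C a : MvPolynomial (Fin 3) k).IsHomogeneous 0 := isHomogeneous_C _ a
  refine (((((((hX 1).pow 2).mul (hX 2)).add ((((hC _).mul (hX 0)).mul (hX 1)).mul (hX 2))).add
    (((hC _).mul (hX 1)).mul ((hX 2).pow 2))).sub ((hX 0).pow 3)).sub
    (((hC _).mul ((hX 0).pow 2)).mul (hX 2))).sub
    (((hC _).mul (hX 0)).mul ((hX 2).pow 2)) |>.sub ((hC _).mul ((hX 2).pow 3))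

theorem weierstrassHomog_eq_polynomial {k : Type} [CommRing k] (W : WeierstrassCurve k) :
    weierstrassHomog W = WeierstrassCurve.Projective.polynomial W := by
  rw [weierstrassHomog, WeierstrassCurve.Projective.polynomial]
  ring

theorem exists_eval_pderiv_weierstrassHomog_ne_zero {K : Type} [Field K]
    {W : WeierstrassCurve K} (hW : W.Δ ≠ 0) (x : Fin 3 → K) (hx : x ≠ 0)
    (h : eval x (weierstrassHomog W) = 0) : ∃ i, eval x (pderiv i (weierstrassHomog W)) ≠ 0 := by
  rw [weierstrassHomog_eq_polynomial] at h ⊢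
  suffices hns : WeierstrassCurve.Projective.Nonsingular W x by
    obtain ⟨-, h0 | h1 | h2⟩ := hns
    exacts [⟨0, h0⟩, ⟨1, h1⟩, ⟨2, h2⟩]
  by_cases hz : x 2 = 0
  · have hx0 : x 0 = 0 := WeierstrassCurve.Projective.X_eq_zero_of_Z_eq_zero h hz
    refine (WeierstrassCurve.Projective.nonsingular_of_Z_eq_zero hz).mpr ⟨h, Or.inr ?_⟩
    have hx1 : x 1 ≠ 0 := fun hx1 => hx (by ext i; fin_cases i <;> assumption)
    simpa [hx0] using hx1
  · rw [WeierstrassCurve.Projective.nonsingular_of_Z_ne_zero hz,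
      ← WeierstrassCurve.Affine.equation_iff_nonsingular_of_Δ_ne_zero hW,
      ← WeierstrassCurve.Projective.equation_of_Z_ne_zero hz]
    exact h

end Weierstrass

section Line

variable {K : Type*} [Field K]

/-- The restriction of `F` to the line `x ↦ a + x b`. -/
def restrictLine {σ : Type*} (a b : σ → K) : MvPolynomial σ K →ₐ[K] Polynomial K :=
  aeval fun i => Polynomial.C (a i) + Polynomial.X * Polynomial.C (b i)

theorem eval_restrictLine {σ : Type*} (a b : σ → K) (F : MvPolynomial σ K) (x : K) :
    (restrictLine a b F).eval x = eval (a + x • b) F := by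
  rw [restrictLine, ← Polynomial.coe_evalRingHom, aeval_def, hom_eval₂, Polynomial.algebraMap_eq,
    show (Polynomial.evalRingHom x).comp Polynomial.C = RingHom.id K by ext; simp, ← eval₂_id]
  congr 1
  ext i
  simp only [Polynomial.coe_evalRingHom, Polynomial.eval_add,
    Polynomial.eval_mul, Polynomial.eval_C, Polynomial.eval_X, Pi.add_apply, Pi.smul_apply,
    smul_eq_mul]

/-- A morphism from the projective line to a smooth plane curve of degree at least `3` is
constant on the complement of a point of the line. -/
theorem eval_add_eq_of_aeval_eq_zero [IsAlgClosed K] [CharZero K] {n : ℕ} (hn : 3 ≤ n)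
    {Q : MvPolynomial (Fin 3) K} (hQ : Q.IsHomogeneous n)
    (hsmooth : ∀ x : Fin 3 → K, x ≠ 0 → eval x Q = 0 → ∃ i, eval x (pderiv i Q) ≠ 0)
    {σ : Type*} {F : Fin 3 → MvPolynomial σ K}
    (hF : ∀ a : σ → K, a ≠ 0 → ∃ i, eval a (F i) ≠ 0) (hFQ : aeval F Q = 0)
    {a b : σ → K} (hab : ∀ x : K, a + x • b ≠ 0) (i : Fin 3) :
    eval (a + b) (F i) = eval a (F i) := by
  have hdeg := natDegree_eq_zero_of_aeval_eq_zero hn hQ hsmooth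
    (p := fun i => restrictLine a b (F i))
    (fun x => by simpa only [eval_restrictLine] using hF _ (hab x))
    (by rw [← comp_aeval_apply, hFQ, map_zero]) i
  have h (x : K) := eval_restrictLine a b (F i) x
  rw [Polynomial.eq_C_of_natDegree_eq_zero hdeg] at h
  simp only [Polynomial.eval_C] at h
  simpa using (h 1).symm.trans (h 0)

theorem exists_eval_eq_smul_of_aeval_eq_zero [IsAlgClosed K] [CharZero K] {n : ℕ} (hn : 3 ≤ n)
    {Q : MvPolynomial (Fin 3) K} (hQ : Q.IsHomogeneous n)
    (hsmooth : ∀ x : Fin 3 → K, x ≠ 0 → eval x Q = 0 → ∃ i, eval x (pderiv i Q) ≠ 0)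
    {σ : Type*} {d : ℕ} {F : Fin 3 → MvPolynomial σ K} (hFd : ∀ i, (F i).IsHomogeneous d)
    (hF : ∀ a : σ → K, a ≠ 0 → ∃ i, eval a (F i) ≠ 0) (hFQ : aeval F Q = 0)
    {a b : σ → K} (ha : a ≠ 0) (hb : b ≠ 0) :
    ∃ u : K, u ≠ 0 ∧ (fun i => eval b (F i)) = u • fun i => eval a (F i) := by
  by_cases hab : ∃ u : K, b = u • a
  · obtain ⟨u, rfl⟩ := hab
    refine ⟨u ^ d, pow_ne_zero d fun hu => hb (by rw [hu, zero_smul]), ?_⟩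
    ext i
    simp [(hFd i).eval_smul]
  have hba (x : K) : b + x • a ≠ 0 := fun h =>
    hab ⟨-x, by rw [neg_smul]; exact eq_neg_of_add_eq_zero_left h⟩
  have hab' (x : K) : a + x • b ≠ 0 := fun h => by
    by_cases hx : x = 0
    · simp [hx, ha] at h
    · refine hba x⁻¹ ?_
      have := congrArg (x⁻¹ • ·) h
      simpa [smul_smul, hx, add_comm] using this
  refine ⟨1, one_ne_zero, ?_⟩
  ext i
  have h₁ := eval_add_eq_of_aeval_eq_zero hn hQ hsmooth hF hFQ hab' i
  have h₂ := eval_add_eq_of_aeval_eq_zero hn hQ hsmooth hF hFQ hba i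
  rw [add_comm] at h₂
  simpa using h₂.symm.trans h₁

end Line

theorem aeval_weierstrassHomog_eq_zero {K : Type} [Field K] [Infinite K] {W : WeierstrassCurve K}
    {Γ : RatCurveData K 2}
    (h : {z | ∃ s t : K, ∃ h : Γ.evalAt s t ≠ 0, z = Projectivization.mk K (Γ.evalAt s t) h} ⊆
      projZeroLocus K {weierstrassHomog W} K) :
    aeval Γ.P (weierstrassHomog W) = 0 := by
  have hG := isHomogeneous_weierstrassHomog W
  refine MvPolynomial.funext fun x => ?_
  have hx : (fun i => eval x (Γ.P i)) = Γ.evalAt (x 0) (x 1) := by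
    ext i
    rw [RatCurveData.evalAt, show ![x 0, x 1] = x by ext j; fin_cases j <;> rfl]
  rw [map_zero, aeval_def, algebraMap_eq, hom_eval₂,
    show (eval x).comp C = RingHom.id K by ext; simp]
  change eval (fun i => eval x (Γ.P i)) (weierstrassHomog W) = 0
  rw [hx]
  by_cases h0 : Γ.evalAt (x 0) (x 1) = 0
  · rw [h0, ← zero_smul K (0 : Fin 3 → K), hG.eval_smul]
    simp
  · have hmem := h ⟨x 0, x 1, h0, rfl⟩ _ rfl
    obtain ⟨u, hu⟩ := Projectivization.exists_smul_eq_mk_rep K _ h0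
    rw [← hu, Algebra.algebraMap_self, MvPolynomial.map_id, Units.smul_def,
      hG.eval_smul] at hmem
    exact (mul_eq_zero.mp hmem).resolve_left (pow_ne_zero 3 u.ne_zero)

/-- Let `K` be an algebraically closed field of characteristic `0` and
let `E ⊆ ℙ²_K` be a smooth Weierstrass cubic (nonvanishing discriminant).  Then `E`
contains no rational curve; equivalently, every morphism `ℙ¹_K → E` is constant.
Concretely: if `F₀, F₁, F₂ ∈ K[s,t]` are homogeneous of the same degree `d ≥ 0` with no
common zero in `ℙ¹(K)` and the Weierstrass equation of `E` vanishes identically when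
evaluated at `(F₀, F₁, F₂)`, then the point `(F₀(s,t) : F₁(s,t) : F₂(s,t)) ∈ ℙ²(K)` is
the same for all `(s : t) ∈ ℙ¹(K)`. -/
theorem statement_12 (K : Type) [Field K] [IsAlgClosed K] [CharZero K]
    (W : WeierstrassCurve K) (hW : W.Δ ≠ 0) :
    (¬ ∃ C : Set (Projectivization K (Fin 3 → K)),
      IsRationalCurve K C ∧ C ⊆ projZeroLocus K {weierstrassHomog W} K) ∧
    (∀ (d : ℕ) (F : Fin 3 → MvPolynomial (Fin 2) K),
      (∀ i, (F i).IsHomogeneous d) →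
      (∀ s t : K, ¬(s = 0 ∧ t = 0) → ¬ ∀ i, eval ![s, t] (F i) = 0) →
      aeval F (weierstrassHomog W) = 0 →
      ∀ s t s' t' : K, ¬(s = 0 ∧ t = 0) → ¬(s' = 0 ∧ t' = 0) →
        ∃ u : K, u ≠ 0 ∧
          (fun i => eval ![s', t'] (F i)) = u • (fun i => eval ![s, t] (F i))) := by
  have hpart (d : ℕ) (F : Fin 3 → MvPolynomial (Fin 2) K) (hd : ∀ i, (F i).IsHomogeneous d)
      (hF : ∀ s t : K, ¬(s = 0 ∧ t = 0) → ¬ ∀ i, eval ![s, t] (F i) = 0)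
      (hFW : aeval F (weierstrassHomog W) = 0) (s t s' t' : K) (hst : ¬(s = 0 ∧ t = 0))
      (hst' : ¬(s' = 0 ∧ t' = 0)) : ∃ u : K, u ≠ 0 ∧
        (fun i => eval ![s', t'] (F i)) = u • (fun i => eval ![s, t] (F i)) := by
    refine exists_eval_eq_smul_of_aeval_eq_zero le_rfl (isHomogeneous_weierstrassHomog W)
      (exists_eval_pderiv_weierstrassHomog_ne_zero hW) hd (fun a ha => ?_) hFW
      (by simpa using hst) (by simpa using hst')
    have haa : a = ![a 0, a 1] := by ext j; fin_cases j <;> rfl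
    rw [haa] at ha ⊢
    exact not_forall.mp (hF _ _ (by simpa using ha))
  refine ⟨?_, hpart⟩
  rintro ⟨_, ⟨Γ, hΓ, ⟨s, t, s', t', hst, hst', hne⟩, rfl⟩, hsub⟩
  obtain ⟨u, -, hu⟩ := hpart Γ.d Γ.P Γ.homog (fun s t hst h => hΓ s t hst (funext h))
    (aeval_weierstrassHomog_eq_zero hsub) s t s' t' hst hst'
  exact hne u hu
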